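/- Let T > 0, let 0 ≤ δ ≤ T/2, let l > 0, and let g : ℝ → ℝ be such that |g(s)| ≤ M for all s and |g(s) − g(s')| ≤ L|s − s'| for all s, s' (L-Lipschitz, bounded by M). Define φ_l(s) = (2l)^{−1}·exp(−|s|/l). Then for every t ∈ [δ, T−δ]: |∫_0^T g(s)·φ_l(t−s) ds − g(t)| ≤ L·δ + 2M·exp(−δ/l). -/

import Mathlib

open MeasureTheory intervalIntegral

lemma ker_left (l t a b : ℝ) (hl : 0 < l) (hab : a ≤ b) (hb : b ≤ t) :
    (∫ s in a..b, ((2 * l)⁻¹ * Real.exp (-|t - s| / l)))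
      = Real.exp ((b - t) / l) / 2 - Real.exp ((a - t) / l) / 2 := by
  have h1 : (∫ s in a..b, ((2 * l)⁻¹ * Real.exp (-|t - s| / l)))
      = ∫ s in a..b, ((2 * l)⁻¹ * Real.exp ((s - t) / l)) := by
    apply intervalIntegral.integral_congr
    intro s hs
    rw [Set.uIcc_of_le hab] at hs
    simp only
    rw [abs_of_nonneg (by linarith [hs.2] : 0 ≤ t - s), neg_sub]
  rw [h1]
  refine intervalIntegral.integral_eq_sub_of_hasDerivAt
    (f := fun s => Real.exp ((s - t) / l) / 2)
    (f' := fun s => ((2 * l)⁻¹ * Real.exp ((s - t) / l))) ?_ ?_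
  · intro s _
    have := ((((hasDerivAt_id s).sub_const t).div_const l).exp).div_const 2
    refine this.congr_deriv ?_
    simp only [id]
    field_simp
  · apply Continuous.intervalIntegrable
    fun_prop

lemma ker_right (l t a b : ℝ) (hl : 0 < l) (hab : a ≤ b) (ha : t ≤ a) :
    (∫ s in a..b, ((2 * l)⁻¹ * Real.exp (-|t - s| / l)))
      = Real.exp ((t - a) / l) / 2 - Real.exp ((t - b) / l) / 2 := by
  have h1 : (∫ s in a..b, ((2 * l)⁻¹ * Real.exp (-|t - s| / l)))
      = ∫ s in a..b, ((2 * l)⁻¹ * Real.exp ((t - s) / l)) := by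
    apply intervalIntegral.integral_congr
    intro s hs
    rw [Set.uIcc_of_le hab] at hs
    simp only
    rw [abs_of_nonpos (by linarith [hs.1] : t - s ≤ 0), neg_neg]
  rw [h1]
  have := intervalIntegral.integral_eq_sub_of_hasDerivAt (a := a) (b := b)
    (f := fun s => -(Real.exp ((t - s) / l) / 2))
    (f' := fun s => ((2 * l)⁻¹ * Real.exp ((t - s) / l))) ?_ ?_
  · rw [this]; ring
  · intro s _
    have := (((((hasDerivAt_id s).const_sub t).div_const l).exp).div_const 2).neg
    refine this.congr_deriv ?_
    simp only [id]
    field_simp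
  · apply Continuous.intervalIntegrable
    fun_prop

lemma ker_bound (l t a b c : ℝ) (hl : 0 < l) (hab : a ≤ b) (h : ℝ → ℝ)
    (hc : ∀ s ∈ Set.Ioc a b, |h s| ≤ c) :
    |∫ s in a..b, h s * ((2 * l)⁻¹ * Real.exp (-|t - s| / l))|
      ≤ c * ∫ s in a..b, ((2 * l)⁻¹ * Real.exp (-|t - s| / l)) := by
  rw [← intervalIntegral.integral_const_mul, ← Real.norm_eq_abs]
  apply intervalIntegral.norm_integral_le_of_norm_le hab
  · refine Filter.Eventually.of_forall fun s hs => ?_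
    have hk : 0 ≤ (2 * l)⁻¹ * Real.exp (-|t - s| / l) := by positivity
    rw [Real.norm_eq_abs, abs_mul, abs_of_nonneg hk]
    exact mul_le_mul_of_nonneg_right (hc s hs) hk
  · apply Continuous.intervalIntegrable
    fun_prop

/-- The mollifier approximation step in the proof of Remark 1: for a bounded Lipschitz `g`
and the two-sided exponential kernel `φ_l`, for every `t ∈ [δ, T−δ]`,
`|∫_0^T g(s)·φ_l(t−s) ds − g(t)| ≤ L·δ + 2M·exp(−δ/l)`. -/
theorem mollifier_approximation
    (T δ l M L : ℝ) (hT : 0 < T) (hδ0 : 0 ≤ δ) (hδT : δ ≤ T / 2) (hl : 0 < l)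
    (g : ℝ → ℝ) (hM : ∀ s, |g s| ≤ M) (hL : ∀ s s', |g s - g s'| ≤ L * |s - s'|) :
    ∀ t ∈ Set.Icc δ (T - δ),
      |(∫ s in (0 : ℝ)..T, g s * ((2 * l)⁻¹ * Real.exp (-|t - s| / l))) - g t|
        ≤ L * δ + 2 * M * Real.exp (-δ / l) := by
  rintro t ⟨ht1, ht2⟩
  have hL0 : 0 ≤ L := by
    have := (abs_nonneg _).trans (hL 1 0)
    simpa using this
  have hg : Continuous g := by
    have : LipschitzWith (Real.toNNReal L) g := by
      apply LipschitzWith.of_dist_le_mul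
      intro x y
      rw [Real.dist_eq, Real.dist_eq, Real.coe_toNNReal L hL0]
      exact hL x y
    exact this.continuous
  have hM0 : 0 ≤ M := (abs_nonneg _).trans (hM 0)
  have hi : ∀ a b, IntervalIntegrable
      (fun s => g s * ((2 * l)⁻¹ * Real.exp (-|t - s| / l))) volume a b := by
    intro a b
    apply Continuous.intervalIntegrable
    fun_prop
  have hk : ∀ a b, IntervalIntegrable
      (fun s => ((2 * l)⁻¹ * Real.exp (-|t - s| / l))) volume a b := by
    intro a b
    apply Continuous.intervalIntegrable
    fun_prop
  have e1 := intervalIntegral.integral_add_adjacent_intervals (hi 0 (t - δ)) (hi (t - δ) (t + δ))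
  have e2 := intervalIntegral.integral_add_adjacent_intervals (hi 0 (t + δ)) (hi (t + δ) T)
  have m1 := ker_left l t 0 (t - δ) hl (by linarith) (by linarith)
  have m2 := ker_left l t (t - δ) t hl (by linarith) le_rfl
  have m3 := ker_right l t t (t + δ) hl (by linarith) le_rfl
  have m4 := ker_right l t (t + δ) T hl (by linarith) (by linarith)
  have m23 := intervalIntegral.integral_add_adjacent_intervals (hk (t - δ) t) (hk t (t + δ))
  have b1 := ker_bound l t 0 (t - δ) M hl (by linarith) g (fun s _ => hM s)
  have b4 := ker_bound l t (t + δ) T M hl (by linarith) g (fun s _ => hM s)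
  have b2 := ker_bound l t (t - δ) (t + δ) (L * δ) hl (by linarith) (fun s => g s - g t) (by
    intro s hs
    refine (hL s t).trans (mul_le_mul_of_nonneg_left ?_ hL0)
    rw [abs_le]
    constructor <;> linarith [hs.1, hs.2])
  have e3 : (∫ s in (t - δ)..(t + δ), (g s - g t) * ((2 * l)⁻¹ * Real.exp (-|t - s| / l)))
      = (∫ s in (t - δ)..(t + δ), g s * ((2 * l)⁻¹ * Real.exp (-|t - s| / l)))
        - g t * ∫ s in (t - δ)..(t + δ), ((2 * l)⁻¹ * Real.exp (-|t - s| / l)) := by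
    rw [← intervalIntegral.integral_const_mul,
      ← intervalIntegral.integral_sub (hi _ _) ((hk _ _).const_mul _)]
    simp only [sub_mul]
  have r1 : t - δ - t = -δ := by ring
  have r2 : t - (t + δ) = -δ := by ring
  rw [r1] at m1 m2
  rw [r2] at m3 m4
  rw [sub_self, zero_div, Real.exp_zero] at m2 m3
  rw [e3, ← m23, m2, m3] at b2
  rw [m1] at b1
  rw [m4] at b4
  rw [← e2, ← e1]
  have p1 := mul_nonneg hM0 (Real.exp_pos ((0 - t) / l)).le
  have p2 := mul_nonneg hM0 (Real.exp_pos ((t - T) / l)).le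
  have p3 := mul_nonneg (mul_nonneg hL0 hδ0) (Real.exp_pos (-δ / l)).le
  have hgt := mul_le_mul_of_nonneg_right (hM t) (Real.exp_pos (-δ / l)).le
  rw [← abs_of_pos (Real.exp_pos (-δ / l)), ← abs_mul, abs_of_pos (Real.exp_pos (-δ / l))] at hgt
  rw [abs_le] at *
  constructor <;> linarith [b1.1, b1.2, b2.1, b2.2, b4.1, b4.2, hgt.1, hgt.2]
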